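/- Discretization stability of the RS formula: let P0 be a probability distribution on ℝ with finite second moment. Then there exists a constant C′ > 0 depending only on P0 such that the following holds. Let ε ∈ (0,1], K > 0 with E_{P0}[X²·1{|X| ≥ K}] ≤ ε², and m ∈ ℕ with K/m ≤ ε; define x̄ = (K/m)·⌊xm/K⌋ for x ∈ [−K,K] and x̄ = 0 otherwise, and let P̄0 be the pushforward of P0 under x ↦ x̄. Then for all λ > 0, |sup_{q ≥ 0} 𝓕_{P0}(λ,q) − sup_{q ≥ 0} 𝓕_{P̄0}(λ,q)| ≤ λ·C′·ε. -/

import Mathlib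

/-!
Discretization stability of the RS formula: let `P0` be a probability distribution on `ℝ`
with finite second moment. Then there exists a constant `C′ > 0` depending only on `P0`
such that the following holds. Let `ε ∈ (0, 1]`, `K > 0` with
`E_{P0}[X² 1{|X| ≥ K}] ≤ ε²`, and `m ∈ ℕ*` with `K/m ≤ ε`; define
`x̄ = (K/m) ⌊xm/K⌋` for `x ∈ [−K, K]` and `x̄ = 0` otherwise, and let `P̄0` be the
pushforward of `P0` under `x ↦ x̄`. Then for all `λ > 0`,
`|sup_{q ≥ 0} 𝓕_{P0}(λ, q) − sup_{q ≥ 0} 𝓕_{P̄0}(λ, q)| ≤ λ C′ ε`.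
-/

open MeasureTheory ProbabilityTheory Filter Finset Real

noncomputable section

/-- The standard Gaussian measure on `ℝ`. -/
def stdGauss : Measure ℝ := gaussianReal 0 1

/-- The scalar free energy
`ψ_{P0}(γ) = E[log ∫ exp(√γ Z x + γ x X − (γ/2) x²) dP0(x)]`. -/
def scalarFE (P0 : Measure ℝ) (γ : ℝ) : ℝ :=
  ∫ x0, (∫ z,
      Real.log (∫ x,
        Real.exp (Real.sqrt γ * z * x + γ * x * x0 - γ / 2 * x ^ 2) ∂P0)
    ∂stdGauss) ∂P0

/-- The Replica-Symmetric potential `𝓕_P(λ, q) = ψ_P(λ q) − (λ/4) q²`. -/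
def RSpot (P : Measure ℝ) (lam q : ℝ) : ℝ :=
  scalarFE P (lam * q) - lam / 4 * q ^ 2

/-- `sup_{q ≥ 0} 𝓕_P(λ, q)`. -/
def RSsup (P : Measure ℝ) (lam : ℝ) : ℝ :=
  sSup (RSpot P lam '' Set.Ici 0)

/-- The discretization map `x ↦ x̄ = (K/m) ⌊xm/K⌋` on `[−K, K]`, `0` outside. -/
def discretize (K : ℝ) (m : ℕ) (x : ℝ) : ℝ :=
  if x ∈ Set.Icc (-K) K then (K / m) * (⌊x * m / K⌋ : ℤ) else 0

section GaussianChannel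

variable {Ω : Type*} [MeasurableSpace Ω]

instance : IsProbabilityMeasure stdGauss := by unfold stdGauss; infer_instance

lemma integrable_sq_stdGauss : Integrable (fun z : ℝ => z ^ 2) stdGauss :=
  (memLp_id_gaussianReal 2).integrable_sq

/-- Cameron–Martin formula for the standard Gaussian on `ℝ`. -/
lemma lintegral_stdGauss_add (F : ℝ → ENNReal) (hF : Measurable F) (c : ℝ) :
    ∫⁻ z, F (z + c) ∂stdGauss
      = ∫⁻ y, ENNReal.ofReal (Real.exp (y * c - c ^ 2 / 2)) * F y ∂stdGauss := by
  have hF' : Measurable fun z => F (z + c) := hF.comp (measurable_id.add_const c)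
  have hG : Measurable fun y => ENNReal.ofReal (Real.exp (y * c - c ^ 2 / 2)) * F y := by
    fun_prop
  rw [stdGauss, gaussianReal_of_var_ne_zero 0 one_ne_zero,
    lintegral_withDensity_eq_lintegral_mul _ (measurable_gaussianPDF 0 1) hF',
    lintegral_withDensity_eq_lintegral_mul _ (measurable_gaussianPDF 0 1) hG,
    ← lintegral_add_right_eq_self _ (-c)]
  refine lintegral_congr fun y => ?_
  simp only [Pi.mul_apply, gaussianPDF, neg_add_cancel_right, ← mul_assoc]
  congr 1
  rw [← ENNReal.ofReal_mul (gaussianPDFReal_nonneg _ _ _)]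
  congr 1
  simp only [gaussianPDFReal, mul_assoc, ← Real.exp_add]
  congr 3
  push_cast
  ring

/-- The likelihood ratio between the law of `u + Z` and the law of `Z`. -/
def likRatio (P : Measure Ω) (u : Ω → ℝ) (y : ℝ) : ℝ :=
  ∫ ω, Real.exp (y * u ω - u ω ^ 2 / 2) ∂P

/-- The conditional expectation of the signal `u` given the observation `u + Z = y`. -/
def postMean (P : Measure Ω) (u : Ω → ℝ) (y : ℝ) : ℝ :=
  (∫ ω, u ω * Real.exp (y * u ω - u ω ^ 2 / 2) ∂P) / likRatio P u y

lemma exp_tilt_le (y u : ℝ) : Real.exp (y * u - u ^ 2 / 2) ≤ Real.exp (y ^ 2 / 2) :=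
  Real.exp_le_exp.2 (by nlinarith [sq_nonneg (y - u)])

variable {P : Measure Ω} {u v : Ω → ℝ}

lemma integrable_mul_exp_tilt {w : Ω → ℝ} (hw : Integrable w P) (hu : Measurable u) (y : ℝ) :
    Integrable (fun ω => w ω * Real.exp (y * u ω - u ω ^ 2 / 2)) P := by
  refine hw.mul_bdd (c := Real.exp (y ^ 2 / 2)) (by fun_prop) (.of_forall fun ω => ?_)
  rw [Real.norm_eq_abs, Real.abs_exp]
  exact exp_tilt_le _ _

lemma lintegral_tilt_mul {w : Ω → ℝ} (hw0 : ∀ ω, 0 ≤ w ω) (hw : Integrable w P)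
    (hu : Measurable u) (y : ℝ) :
    ∫⁻ ω, ENNReal.ofReal (w ω) * ENNReal.ofReal (Real.exp (y * u ω - u ω ^ 2 / 2)) ∂P
      = ENNReal.ofReal (∫ ω, w ω * Real.exp (y * u ω - u ω ^ 2 / 2) ∂P) := by
  rw [ofReal_integral_eq_lintegral_ofReal (integrable_mul_exp_tilt hw hu y)
    (.of_forall fun ω => mul_nonneg (hw0 ω) (Real.exp_pos _).le)]
  exact lintegral_congr fun ω => (ENNReal.ofReal_mul (hw0 ω)).symm

variable [IsProbabilityMeasure P]

lemma integrable_exp_tilt (hu : Measurable u) (y : ℝ) :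
    Integrable (fun ω => Real.exp (y * u ω - u ω ^ 2 / 2)) P := by
  simpa using integrable_mul_exp_tilt (P := P) (integrable_const 1) hu y

lemma likRatio_pos (hu : Measurable u) (y : ℝ) : 0 < likRatio P u y :=
  integral_exp_pos (integrable_exp_tilt hu y)

lemma likRatio_le (hu : Measurable u) (y : ℝ) : likRatio P u y ≤ Real.exp (y ^ 2 / 2) := by
  have := integral_mono (μ := P) (integrable_exp_tilt hu y) (integrable_const _)
    fun ω => exp_tilt_le y (u ω)
  simpa [likRatio] using this

lemma measurable_likRatio (hu : Measurable u) : Measurable (likRatio P u) := by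
  have h : StronglyMeasurable fun p : ℝ × Ω => Real.exp (p.1 * u p.2 - u p.2 ^ 2 / 2) :=
    Measurable.stronglyMeasurable (by fun_prop)
  exact h.integral_prod_right'.measurable

lemma measurable_postMean (hu : Measurable u) : Measurable (postMean P u) := by
  have h : StronglyMeasurable
      fun p : ℝ × Ω => u p.2 * Real.exp (p.1 * u p.2 - u p.2 ^ 2 / 2) :=
    Measurable.stronglyMeasurable (by fun_prop)
  exact h.integral_prod_right'.measurable.div (measurable_likRatio hu)

lemma postMean_mul_likRatio (hu : Measurable u) (y : ℝ) :
    postMean P u y * likRatio P u y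
      = ∫ ω, u ω * Real.exp (y * u ω - u ω ^ 2 / 2) ∂P :=
  div_mul_cancel₀ _ (likRatio_pos hu y).ne'

/-- The logarithm of the likelihood ratio lies above its tangents. -/
lemma log_likRatio_sub_le (hu : Measurable u) (hui : Integrable u P) (y₁ y₂ : ℝ) :
    Real.log (likRatio P u y₁) - Real.log (likRatio P u y₂) ≤ (y₁ - y₂) * postMean P u y₁ := by
  have hL₁ := likRatio_pos (P := P) hu y₁
  set a := (y₂ - y₁) * postMean P u y₁ with ha
  have hi₁ := integrable_exp_tilt (P := P) hu y₁
  have hi₂ := integrable_mul_exp_tilt hui hu y₁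
  have key : Real.exp a * likRatio P u y₁ ≤ likRatio P u y₂ := by
    have hI : ∫ ω, Real.exp a * ((1 - a) * Real.exp (y₁ * u ω - u ω ^ 2 / 2)
        + (y₂ - y₁) * (u ω * Real.exp (y₁ * u ω - u ω ^ 2 / 2))) ∂P
        = Real.exp a * likRatio P u y₁ := by
      rw [integral_const_mul, integral_add (hi₁.const_mul _) (hi₂.const_mul _),
        integral_const_mul, integral_const_mul, ← postMean_mul_likRatio hu]
      change Real.exp a * ((1 - a) * likRatio P u y₁ + _) = _
      rw [ha]
      ring
    rw [← hI]
    refine integral_mono (((hi₁.const_mul _).add (hi₂.const_mul _)).const_mul _)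
      (integrable_exp_tilt hu y₂) fun ω => ?_
    have h := Real.add_one_le_exp ((y₂ - y₁) * u ω - a)
    have e : Real.exp (y₂ * u ω - u ω ^ 2 / 2) = Real.exp a * Real.exp (y₁ * u ω - u ω ^ 2 / 2)
        * Real.exp ((y₂ - y₁) * u ω - a) := by
      rw [← Real.exp_add, ← Real.exp_add]
      ring_nf
    have := mul_le_mul_of_nonneg_left h
      (mul_pos (Real.exp_pos a) (Real.exp_pos (y₁ * u ω - u ω ^ 2 / 2))).le
    simp only [e]
    linarith
  have h := Real.log_le_log (mul_pos (Real.exp_pos a) hL₁) key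
  rw [Real.log_mul (Real.exp_pos a).ne' hL₁.ne', Real.log_exp] at h
  linarith

lemma le_log_likRatio (hu : Measurable u) (hui : Integrable u P)
    (hu2 : Integrable (fun ω => u ω ^ 2) P) (y : ℝ) :
    y * ∫ ω, u ω ∂P - (∫ ω, u ω ^ 2 ∂P) / 2 ≤ Real.log (likRatio P u y) := by
  rw [Real.le_log_iff_exp_le (likRatio_pos hu y)]
  have h := convexOn_exp.map_integral_le (μ := P) (f := fun ω => y * u ω - u ω ^ 2 / 2)
    continuousOn_exp isClosed_univ (by simp) ((hui.const_mul y).sub (hu2.div_const 2))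
    (integrable_exp_tilt hu y)
  rwa [integral_sub (hui.const_mul y) (hu2.div_const 2), integral_const_mul,
    integral_div] at h

lemma integrable_of_sq (hu : Measurable u) (hu2 : Integrable (fun ω => u ω ^ 2) P) :
    Integrable u P :=
  ((memLp_two_iff_integrable_sq hu.aestronglyMeasurable).2 hu2).integrable (by norm_num)

lemma sq_integral_le (hu : Measurable u) (hu2 : Integrable (fun ω => u ω ^ 2) P) :
    (∫ ω, u ω ∂P) ^ 2 ≤ ∫ ω, u ω ^ 2 ∂P := by
  have h := (even_two.convexOn_pow (𝕜 := ℝ)).map_integral_le (μ := P) (f := u)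
    (continuous_pow 2).continuousOn isClosed_univ (by simp) (integrable_of_sq hu hu2) hu2
  exact h

lemma abs_log_likRatio_le (hu : Measurable u) (hu2 : Integrable (fun ω => u ω ^ 2) P) (y : ℝ) :
    |Real.log (likRatio P u y)| ≤ y ^ 2 + ∫ ω, u ω ^ 2 ∂P := by
  have h₁ := le_log_likRatio hu (integrable_of_sq hu hu2) hu2 y
  have h₂ := Real.log_le_log (likRatio_pos hu y) (likRatio_le (P := P) hu y)
  rw [Real.log_exp] at h₂
  have h₃ := sq_integral_le hu hu2
  have h₄ : 0 ≤ ∫ ω, u ω ^ 2 ∂P := integral_nonneg fun ω => sq_nonneg _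
  rw [abs_le]
  constructor
  · nlinarith [sq_nonneg (y + ∫ ω, u ω ∂P), sq_nonneg y]
  · nlinarith [sq_nonneg y]

lemma integrable_observation_sq (hu : Measurable u) (hu2 : Integrable (fun ω => u ω ^ 2) P) :
    Integrable (fun p : Ω × ℝ => (p.2 + u p.1) ^ 2) (P.prod stdGauss) := by
  refine (((integrable_sq_stdGauss.comp_snd P).const_mul 2).add
    ((hu2.comp_fst stdGauss).const_mul 2)).mono'
    (Measurable.aestronglyMeasurable (by fun_prop)) (.of_forall fun p => ?_)
  rw [Real.norm_eq_abs, abs_of_nonneg (sq_nonneg _)]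
  simp only [Pi.add_apply]
  nlinarith [sq_nonneg (p.2 - u p.1)]

lemma integrable_log_likRatio (hu : Measurable u) (hu2 : Integrable (fun ω => u ω ^ 2) P)
    (hv : Measurable v) (hv2 : Integrable (fun ω => v ω ^ 2) P) :
    Integrable (fun p : Ω × ℝ => Real.log (likRatio P u (p.2 + v p.1))) (P.prod stdGauss) := by
  refine ((integrable_observation_sq hv hv2).add
    (integrable_const (∫ ω, u ω ^ 2 ∂P))).mono' ?_
    (.of_forall fun p => abs_log_likRatio_le hu hu2 _)
  have := measurable_likRatio (P := P) hu
  exact Measurable.aestronglyMeasurable (by fun_prop)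

/-- The joint law of signal and observation, in terms of an observation with law `stdGauss`. -/
lemma lintegral_observation {w : Ω → ℝ} (hw0 : ∀ ω, 0 ≤ w ω) (hwm : Measurable w)
    (hw : Integrable w P) (hu : Measurable u) {F : ℝ → ENNReal} (hF : Measurable F) :
    ∫⁻ p : Ω × ℝ, ENNReal.ofReal (w p.1) * F (p.2 + u p.1) ∂(P.prod stdGauss)
      = ∫⁻ y, ENNReal.ofReal (∫ ω, w ω * Real.exp (y * u ω - u ω ^ 2 / 2) ∂P) * F y
          ∂stdGauss := by
  rw [lintegral_prod _ (by fun_prop)]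
  have h₁ : ∀ ω, ∫⁻ z, ENNReal.ofReal (w ω) * F (z + u ω) ∂stdGauss
      = ∫⁻ y, ENNReal.ofReal (w ω) * ENNReal.ofReal (Real.exp (y * u ω - u ω ^ 2 / 2)) * F y
          ∂stdGauss := fun ω => by
    rw [lintegral_const_mul _ (by fun_prop), lintegral_stdGauss_add F hF,
      ← lintegral_const_mul _ (by fun_prop)]
    simp only [mul_assoc]
  simp only [h₁]
  rw [lintegral_lintegral_swap (by fun_prop)]
  refine lintegral_congr fun y => ?_
  rw [lintegral_mul_const _ (by fun_prop), lintegral_tilt_mul hw0 hw hu]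

lemma lintegral_observation_one (hu : Measurable u) {F : ℝ → ENNReal} (hF : Measurable F) :
    ∫⁻ p : Ω × ℝ, F (p.2 + u p.1) ∂(P.prod stdGauss)
      = ∫⁻ y, ENNReal.ofReal (likRatio P u y) * F y ∂stdGauss := by
  simpa [likRatio] using lintegral_observation (P := P) (w := fun _ => 1)
    (fun _ => zero_le_one) measurable_const (integrable_const 1) hu hF

lemma lintegral_likRatio_div (hu : Measurable u) (hv : Measurable v) :
    ∫⁻ p : Ω × ℝ, ENNReal.ofReal (likRatio P u (p.2 + v p.1) / likRatio P v (p.2 + v p.1))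
      ∂(P.prod stdGauss) = 1 := by
  have hLu := measurable_likRatio (P := P) hu
  have hLv := measurable_likRatio (P := P) hv
  rw [lintegral_observation_one (F := fun y => ENNReal.ofReal (likRatio P u y / likRatio P v y))
    hv (by fun_prop)]
  have h : ∀ y, ENNReal.ofReal (likRatio P v y)
      * ENNReal.ofReal (likRatio P u y / likRatio P v y)
      = ENNReal.ofReal (likRatio P u y) * 1 := fun y => by
    rw [← ENNReal.ofReal_mul (likRatio_pos hv y).le,
      mul_div_cancel₀ _ (likRatio_pos hv y).ne', mul_one]
  simp only [h]
  rw [← lintegral_observation_one (F := fun _ => 1) hu measurable_const]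
  simp

/-- Gibbs' inequality for two Gaussian channel outputs. -/
lemma integral_log_likRatio_le (hu : Measurable u) (hu2 : Integrable (fun ω => u ω ^ 2) P)
    (hv : Measurable v) (hv2 : Integrable (fun ω => v ω ^ 2) P) :
    ∫ p : Ω × ℝ, Real.log (likRatio P u (p.2 + v p.1)) ∂(P.prod stdGauss)
      ≤ ∫ p : Ω × ℝ, Real.log (likRatio P v (p.2 + v p.1)) ∂(P.prod stdGauss) := by
  have hLu := measurable_likRatio (P := P) hu
  have hLv := measurable_likRatio (P := P) hv
  have h1 := lintegral_likRatio_div (P := P) hu hv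
  have hnn : ∀ p : Ω × ℝ, 0 ≤ likRatio P u (p.2 + v p.1) / likRatio P v (p.2 + v p.1) :=
    fun p => (div_pos (likRatio_pos hu _) (likRatio_pos hv _)).le
  have hm : Measurable fun p : Ω × ℝ =>
      likRatio P u (p.2 + v p.1) / likRatio P v (p.2 + v p.1) := by fun_prop
  have hi : Integrable (fun p : Ω × ℝ =>
      likRatio P u (p.2 + v p.1) / likRatio P v (p.2 + v p.1)) (P.prod stdGauss) :=
    ⟨hm.aestronglyMeasurable, by
      rw [hasFiniteIntegral_iff_ofReal (.of_forall hnn), h1]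
      exact ENNReal.one_lt_top⟩
  have hI : ∫ p : Ω × ℝ, likRatio P u (p.2 + v p.1) / likRatio P v (p.2 + v p.1)
      ∂(P.prod stdGauss) = 1 := by
    rw [integral_eq_lintegral_of_nonneg_ae (.of_forall hnn) hm.aestronglyMeasurable, h1]
    simp
  have hlu := integrable_log_likRatio hu hu2 hv hv2
  have hlv := integrable_log_likRatio hv hv2 hv hv2
  have h := integral_mono (hlu.sub hlv) (hi.sub (integrable_const 1)) fun p => by
    have := Real.log_le_sub_one_of_pos
      (div_pos (likRatio_pos (P := P) hu (p.2 + v p.1)) (likRatio_pos (P := P) hv (p.2 + v p.1)))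
    rwa [Real.log_div (likRatio_pos hu _).ne' (likRatio_pos hv _).ne'] at this
  rw [integral_sub' hlu hlv, integral_sub' hi (integrable_const 1), hI] at h
  simp only [integral_const, probReal_univ, smul_eq_mul, mul_one, sub_self] at h
  linarith

lemma likRatio_mul_postMean_sq_le (hu : Measurable u)
    (hu2 : Integrable (fun ω => u ω ^ 2) P) (y : ℝ) :
    likRatio P u y * postMean P u y ^ 2
      ≤ ∫ ω, u ω ^ 2 * Real.exp (y * u ω - u ω ^ 2 / 2) ∂P := by
  set m := postMean P u y with hm
  have hi₀ := integrable_exp_tilt (P := P) hu y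
  have hi₁ := integrable_mul_exp_tilt (integrable_of_sq hu hu2) hu y
  have hi₂ := integrable_mul_exp_tilt hu2 hu y
  have h : 0 ≤ ∫ ω, (u ω ^ 2 * Real.exp (y * u ω - u ω ^ 2 / 2)
      - 2 * m * (u ω * Real.exp (y * u ω - u ω ^ 2 / 2)))
      + m ^ 2 * Real.exp (y * u ω - u ω ^ 2 / 2) ∂P :=
    integral_nonneg fun ω => by
      have := mul_nonneg (sq_nonneg (u ω - m)) (Real.exp_pos (y * u ω - u ω ^ 2 / 2)).le
      simp only [Pi.zero_apply]
      linarith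
  have hi₃ : Integrable (fun ω => u ω ^ 2 * Real.exp (y * u ω - u ω ^ 2 / 2)
      - 2 * m * (u ω * Real.exp (y * u ω - u ω ^ 2 / 2))) P := hi₂.sub (hi₁.const_mul _)
  rw [integral_add hi₃ (hi₀.const_mul _), integral_sub hi₂ (hi₁.const_mul _), integral_const_mul, integral_const_mul,
    ← postMean_mul_likRatio hu, ← hm] at h
  change 0 ≤ _ - 2 * m * (m * likRatio P u y) + m ^ 2 * likRatio P u y at h
  linarith

lemma lintegral_postMean_sq_le (hu : Measurable u) (hu2 : Integrable (fun ω => u ω ^ 2) P) :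
    ∫⁻ p : Ω × ℝ, ENNReal.ofReal (postMean P u (p.2 + u p.1) ^ 2) ∂(P.prod stdGauss)
      ≤ ENNReal.ofReal (∫ ω, u ω ^ 2 ∂P) := by
  have hm := measurable_postMean (P := P) hu
  rw [lintegral_observation_one (F := fun y => ENNReal.ofReal (postMean P u y ^ 2)) hu
    (by fun_prop)]
  calc _ ≤ ∫⁻ y, ENNReal.ofReal (∫ ω, u ω ^ 2 * Real.exp (y * u ω - u ω ^ 2 / 2) ∂P) * 1
          ∂stdGauss := by
        refine lintegral_mono fun y => ?_
        rw [← ENNReal.ofReal_mul (likRatio_pos hu y).le, mul_one]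
        exact ENNReal.ofReal_le_ofReal (likRatio_mul_postMean_sq_le hu hu2 y)
    _ = ∫⁻ p : Ω × ℝ, ENNReal.ofReal (u p.1 ^ 2) * 1 ∂(P.prod stdGauss) :=
        (lintegral_observation (w := fun ω => u ω ^ 2) (F := fun _ => 1)
          (fun ω => sq_nonneg _) (by fun_prop) hu2 hu measurable_const).symm
    _ = ENNReal.ofReal (∫ ω, u ω ^ 2 ∂P) := by
        rw [lintegral_prod _ (by fun_prop)]
        simp [ofReal_integral_eq_lintegral_ofReal hu2 (.of_forall fun ω => sq_nonneg _)]

lemma integrable_postMean_sq (hu : Measurable u) (hu2 : Integrable (fun ω => u ω ^ 2) P) :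
    Integrable (fun p : Ω × ℝ => postMean P u (p.2 + u p.1) ^ 2) (P.prod stdGauss) := by
  have hm := measurable_postMean (P := P) hu
  refine ⟨Measurable.aestronglyMeasurable (by fun_prop), ?_⟩
  rw [hasFiniteIntegral_iff_ofReal (.of_forall fun p => sq_nonneg _)]
  exact (lintegral_postMean_sq_le hu hu2).trans_lt ENNReal.ofReal_lt_top

lemma integral_postMean_sq_le (hu : Measurable u) (hu2 : Integrable (fun ω => u ω ^ 2) P) :
    ∫ p : Ω × ℝ, postMean P u (p.2 + u p.1) ^ 2 ∂(P.prod stdGauss) ≤ ∫ ω, u ω ^ 2 ∂P := by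
  have hm := measurable_postMean (P := P) hu
  rw [integral_eq_lintegral_of_nonneg_ae (.of_forall fun p => sq_nonneg _)
    (Measurable.aestronglyMeasurable (by fun_prop))]
  exact ENNReal.toReal_le_of_le_ofReal (integral_nonneg fun ω => sq_nonneg _)
    (lintegral_postMean_sq_le hu hu2)

/-- The relative entropy of the law of `u + Z` with respect to the law of `Z`. -/
def channelEntropy (P : Measure Ω) (u : Ω → ℝ) : ℝ :=
  ∫ p : Ω × ℝ, Real.log (likRatio P u (p.2 + u p.1)) ∂(P.prod stdGauss)

/-- Wasserstein continuity of the output entropy of a Gaussian channel. -/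
lemma channelEntropy_sub_le (hu : Measurable u) (hu2 : Integrable (fun ω => u ω ^ 2) P)
    (hv : Measurable v) (hv2 : Integrable (fun ω => v ω ^ 2) P) {a : ℝ} (ha : 0 < a) :
    channelEntropy P u - channelEntropy P v
      ≤ (a * ∫ ω, u ω ^ 2 ∂P + a⁻¹ * ∫ ω, (u ω - v ω) ^ 2 ∂P) / 2 := by
  have hd : Integrable (fun ω => (u ω - v ω) ^ 2) P :=
    (((memLp_two_iff_integrable_sq hu.aestronglyMeasurable).2 hu2).sub
      ((memLp_two_iff_integrable_sq hv.aestronglyMeasurable).2 hv2)).integrable_sq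
  have hd' := hd.comp_fst stdGauss
  have hm := integrable_postMean_sq hu hu2
  have hlu := integrable_log_likRatio hu hu2 hu hu2
  have hlv := integrable_log_likRatio hu hu2 hv hv2
  have h := integral_mono (hlu.sub hlv) (((hm.const_mul a).add (hd'.const_mul a⁻¹)).div_const 2)
    fun p => by
      have h₁ := log_likRatio_sub_le hu (integrable_of_sq hu hu2) (p.2 + u p.1) (p.2 + v p.1)
      set m := postMean P u (p.2 + u p.1) with hm_def
      have h₂ : 0 ≤ a⁻¹ * (a * m - (u p.1 - v p.1)) ^ 2 := by positivity
      have h₃ : a⁻¹ * (a * m - (u p.1 - v p.1)) ^ 2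
          = a * m ^ 2 + a⁻¹ * (u p.1 - v p.1) ^ 2 - 2 * ((u p.1 - v p.1) * m) := by
        field_simp
        ring
      simp only [Pi.sub_apply, Pi.add_apply, ← hm_def]
      linarith
  rw [integral_sub' hlu hlv, integral_div, integral_add' (hm.const_mul a) (hd'.const_mul a⁻¹),
    integral_const_mul, integral_const_mul, integral_fun_fst (fun ω => (u ω - v ω) ^ 2)] at h
  simp only [probReal_univ, one_smul] at h
  have hg := integral_log_likRatio_le hu hu2 hv hv2
  have hmm := mul_le_mul_of_nonneg_left (integral_postMean_sq_le hu hu2) ha.le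
  unfold channelEntropy
  linarith

lemma channelEntropy_zero : channelEntropy P (fun _ => 0) = 0 := by
  simp [channelEntropy, likRatio]

lemma scalarFE_map (hu : Measurable u) (hu2 : Integrable (fun ω => u ω ^ 2) P)
    {γ : ℝ} (hγ : 0 ≤ γ) :
    scalarFE (P.map u) γ = channelEntropy P (fun ω => √γ * u ω) := by
  have hsu : Measurable fun ω => √γ * u ω := by fun_prop
  have hsu2 : Integrable (fun ω => (√γ * u ω) ^ 2) P := by
    simpa only [mul_pow] using hu2.const_mul (√γ ^ 2)
  have hexp : ∀ x₀ z : ℝ, ∫ x, Real.exp (√γ * z * x + γ * x * x₀ - γ / 2 * x ^ 2) ∂(P.map u)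
      = likRatio P (fun ω => √γ * u ω) (z + √γ * x₀) := fun x₀ z => by
    rw [integral_map hu.aemeasurable (Measurable.aestronglyMeasurable (by fun_prop)), likRatio]
    congr with ω
    congr 1
    linear_combination (u ω ^ 2 / 2 - u ω * x₀) * Real.sq_sqrt hγ
  simp only [scalarFE, hexp]
  rw [channelEntropy, integral_prod _ (integrable_log_likRatio hsu hsu2 hsu hsu2)]
  have hL := measurable_likRatio (P := P) hsu
  rw [integral_map hu.aemeasurable]
  have h : StronglyMeasurable fun p : ℝ × ℝ =>
      Real.log (likRatio P (fun ω => √γ * u ω) (p.2 + √γ * p.1)) :=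
    Measurable.stronglyMeasurable (by fun_prop)
  exact h.integral_prod_right'.aestronglyMeasurable

lemma scalarFE_map_sub_le (hu : Measurable u) (hu2 : Integrable (fun ω => u ω ^ 2) P)
    (hv : Measurable v) (hv2 : Integrable (fun ω => v ω ^ 2) P) {a : ℝ} (ha : 0 < a)
    {γ : ℝ} (hγ : 0 ≤ γ) :
    scalarFE (P.map u) γ - scalarFE (P.map v) γ
      ≤ γ * ((a * ∫ ω, u ω ^ 2 ∂P + a⁻¹ * ∫ ω, (u ω - v ω) ^ 2 ∂P) / 2) := by
  rw [scalarFE_map hu hu2 hγ, scalarFE_map hv hv2 hγ]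
  have hsq : ∀ w : Ω → ℝ, Integrable (fun ω => w ω ^ 2) P →
      Integrable (fun ω => (√γ * w ω) ^ 2) P := fun w hw => by
    simpa only [mul_pow] using hw.const_mul (√γ ^ 2)
  have h := channelEntropy_sub_le (hu.const_mul √γ) (hsq u hu2) (hv.const_mul √γ) (hsq v hv2) ha
  simp only [← mul_sub, mul_pow, Real.sq_sqrt hγ, integral_const_mul] at h
  linarith

lemma scalarFE_map_le (hu : Measurable u) (hu2 : Integrable (fun ω => u ω ^ 2) P)
    {γ : ℝ} (hγ : 0 ≤ γ) : scalarFE (P.map u) γ ≤ γ * ∫ ω, u ω ^ 2 ∂P := by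
  have h := scalarFE_map_sub_le (v := fun _ => 0) hu hu2 measurable_const (by simp) one_pos hγ
  rw [scalarFE_map (u := fun _ => (0 : ℝ)) measurable_const (by simp) hγ] at h
  simp only [mul_zero, channelEntropy_zero, sub_zero] at h
  linarith

lemma RSpot_map_zero (hu : Measurable u) (lam : ℝ) : RSpot (P.map u) lam 0 = 0 := by
  have := Measure.isProbabilityMeasure_map (μ := P) hu.aemeasurable
  simp [RSpot, scalarFE]

lemma bddAbove_RSpot_map (hu : Measurable u) (hu2 : Integrable (fun ω => u ω ^ 2) P)
    {lam : ℝ} (hlam : 0 < lam) : BddAbove (RSpot (P.map u) lam '' Set.Ici 0) := by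
  refine ⟨lam * (∫ ω, u ω ^ 2 ∂P) ^ 2, ?_⟩
  rintro _ ⟨q, hq, rfl⟩
  have h := scalarFE_map_le hu hu2 (mul_nonneg hlam.le hq)
  have := mul_nonneg hlam.le (sq_nonneg (∫ ω, u ω ^ 2 ∂P - q / 2))
  unfold RSpot
  linarith

lemma RSsup_map_sub_le (hu : Measurable u) (hu2 : Integrable (fun ω => u ω ^ 2) P)
    (hv : Measurable v) (hv2 : Integrable (fun ω => v ω ^ 2) P) {ε M : ℝ} (hε : 0 < ε)
    (hM : ∫ ω, u ω ^ 2 ∂P ≤ M) (hd : ∫ ω, (u ω - v ω) ^ 2 ∂P ≤ 2 * ε ^ 2)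
    {lam : ℝ} (hlam : 0 < lam) :
    RSsup (P.map u) lam - RSsup (P.map v) lam ≤ lam * (2 * M * (M + 2)) * ε := by
  have hM0 : 0 ≤ M := (integral_nonneg fun ω => sq_nonneg _).trans hM
  have hbdd := bddAbove_RSpot_map hv hv2 hlam
  have hle : ∀ q, 0 ≤ q → RSpot (P.map v) lam q ≤ RSsup (P.map v) lam := fun q hq =>
    le_csSup hbdd ⟨q, hq, rfl⟩
  have hsup0 : 0 ≤ RSsup (P.map v) lam := by
    simpa only [RSpot_map_zero hv] using hle 0 le_rfl
  rw [sub_le_iff_le_add]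
  refine csSup_le (Set.nonempty_Ici.image _) ?_
  rintro _ ⟨q, hq : 0 ≤ q, rfl⟩
  have hlq : 0 ≤ lam * q := mul_nonneg hlam.le hq
  rcases le_total (4 * M) q with hqM | hqM
  · have h := scalarFE_map_le hu hu2 hlq
    have h₁ := mul_le_mul_of_nonneg_left hM hlq
    have h₂ := mul_le_mul_of_nonneg_left hqM hlq
    have h₃ : 0 ≤ lam * (2 * M * (M + 2)) * ε := by positivity
    unfold RSpot
    linarith
  · have h := scalarFE_map_sub_le hu hu2 hv hv2 hε hlq
    have h₁ : (ε * ∫ ω, u ω ^ 2 ∂P + ε⁻¹ * ∫ ω, (u ω - v ω) ^ 2 ∂P) / 2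
        ≤ (ε * M + ε⁻¹ * (2 * ε ^ 2)) / 2 := by gcongr
    have h₂ : (ε * M + ε⁻¹ * (2 * ε ^ 2)) / 2 = ε * (M + 2) / 2 := by
      field_simp
    have h₃ := mul_le_mul_of_nonneg_left (h₁.trans_eq h₂) hlq
    have h₄ : lam * q * (ε * (M + 2) / 2) ≤ lam * (4 * M) * (ε * (M + 2) / 2) := by gcongr
    have h₅ := hle q hq
    unfold RSpot at h₅ ⊢
    linarith

end GaussianChannel

lemma measurable_discretize (K : ℝ) (m : ℕ) : Measurable (discretize K m) := by
  refine Measurable.ite measurableSet_Icc ?_ measurable_const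
  have : Measurable fun x : ℝ => ⌊x * m / K⌋ := Int.measurable_floor.comp (by fun_prop)
  exact ((measurable_of_countable fun n : ℤ => (n : ℝ)).comp this).const_mul _

lemma sq_sub_discretize_le {K ε : ℝ} (hK : 0 < K) {m : ℕ} (hm : 0 < m) (hKm : K / m ≤ ε)
    (x : ℝ) :
    (x - discretize K m x) ^ 2 ≤ ε ^ 2 + {x : ℝ | K ≤ |x|}.indicator (fun x => x ^ 2) x := by
  have hm' : (0 : ℝ) < m := by exact_mod_cast hm
  unfold discretize
  split_ifs with h
  · have h₁ := Int.floor_le (x * m / K)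
    have h₂ := (Int.lt_floor_add_one (x * m / K)).le
    have hpos : 0 < K / m := div_pos hK hm'
    have hx : x = K / m * (x * m / K) := by field_simp
    have h₃ := mul_le_mul_of_nonneg_left h₁ hpos.le
    have h₄ := mul_le_mul_of_nonneg_left h₂ hpos.le
    rw [← hx] at h₃ h₄
    have h₅ : (x - K / m * (⌊x * m / K⌋ : ℤ)) ^ 2 ≤ ε ^ 2 :=
      pow_le_pow_left₀ (by linarith) (by linarith) 2
    have h₆ : 0 ≤ {x : ℝ | K ≤ |x|}.indicator (fun x => x ^ 2) x :=
      Set.indicator_nonneg (fun x _ => sq_nonneg x) x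
    linarith
  · have hx : x ∈ {x : ℝ | K ≤ |x|} := by
      by_contra hc
      exact h (abs_le.1 (not_le.1 hc).le)
    rw [Set.indicator_of_mem hx, sub_zero]
    linarith [sq_nonneg ε]

/-- **Discretization stability of the RS formula.** -/
theorem rs_sup_discretization_stability (P0 : Measure ℝ) [IsProbabilityMeasure P0]
    (hmom : Integrable (fun x => x ^ 2) P0) :
    ∃ C' > (0 : ℝ), ∀ ε ∈ Set.Ioc (0 : ℝ) 1, ∀ K > (0 : ℝ),
      (∫ x in {x : ℝ | K ≤ |x|}, x ^ 2 ∂P0) ≤ ε ^ 2 →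
      ∀ m : ℕ, 0 < m → K / m ≤ ε →
      ∀ lam > (0 : ℝ),
        |RSsup P0 lam - RSsup (Measure.map (discretize K m) P0) lam| ≤ lam * C' * ε := by
  have hmom0 : 0 ≤ ∫ x, x ^ 2 ∂P0 := integral_nonneg fun x => sq_nonneg x
  set M : ℝ := 2 * ∫ x, x ^ 2 ∂P0 + 4 with hM
  refine ⟨2 * M * (M + 2), by positivity, ?_⟩
  rintro ε ⟨hε, hε1⟩ K hK htail m hm hKm lam hlam
  have hf := measurable_discretize K m
  have hset : MeasurableSet {x : ℝ | K ≤ |x|} := measurableSet_le measurable_const (by fun_prop)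
  have hbound : Integrable
      (fun x => ε ^ 2 + {x : ℝ | K ≤ |x|}.indicator (fun x => x ^ 2) x) P0 :=
    (integrable_const _).add (hmom.indicator hset)
  have hdi : Integrable (fun x => (x - discretize K m x) ^ 2) P0 :=
    hbound.mono' (Measurable.aestronglyMeasurable (by fun_prop)) (.of_forall fun x => by
      rw [Real.norm_eq_abs, abs_of_nonneg (sq_nonneg _)]
      exact sq_sub_discretize_le hK hm hKm x)
  have hd : ∫ x, (x - discretize K m x) ^ 2 ∂P0 ≤ 2 * ε ^ 2 := by
    have h := integral_mono hdi hbound fun x => sq_sub_discretize_le hK hm hKm x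
    rw [integral_add (integrable_const _) (hmom.indicator hset), integral_indicator hset] at h
    simp only [integral_const, probReal_univ, smul_eq_mul, one_mul] at h
    linarith
  have hle : ∀ x, discretize K m x ^ 2 ≤ 2 * x ^ 2 + 2 * (x - discretize K m x) ^ 2 := fun x => by
    nlinarith [sq_nonneg (2 * x - discretize K m x)]
  have hbound2 := (hmom.const_mul 2).add (hdi.const_mul 2)
  have hf2 : Integrable (fun x => discretize K m x ^ 2) P0 :=
    hbound2.mono' (Measurable.aestronglyMeasurable (by fun_prop)) (.of_forall fun x => by
      rw [Real.norm_eq_abs, abs_of_nonneg (sq_nonneg _)]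
      exact hle x)
  have hfM : ∫ x, discretize K m x ^ 2 ∂P0 ≤ M := by
    have h := integral_mono hf2 hbound2 hle
    rw [integral_add' (hmom.const_mul 2) (hdi.const_mul 2), integral_const_mul,
      integral_const_mul] at h
    have : ε ^ 2 ≤ 1 := pow_le_one₀ hε.le hε1
    linarith
  have h₁ := RSsup_map_sub_le (u := fun x => x) measurable_id hmom hf hf2 hε
    (by linarith : ∫ x, x ^ 2 ∂P0 ≤ M) hd hlam
  have h₂ := RSsup_map_sub_le (v := fun x => x) hf hf2 measurable_id hmom hε hfM
    (by simpa only [sub_sq_comm] using hd) hlam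
  rw [Measure.map_id'] at h₁ h₂
  exact abs_le.2 ⟨by linarith, h₁⟩

end
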